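/- Fix smooth vector fields f₁, …, f_m : ℝⁿ → ℝⁿ and x̄ ∈ ℝⁿ, and let V be the associated value function. Let u : [0,1] → ℝᵐ be a bounded measurable control with a trajectory γ : [0,1] → ℝⁿ satisfying γ(0) = x̄. Then for every t ∈ (0,1), V(γ(1)) ≤ (1/t)·V(γ(t)) + ∫_t^1 Σᵢ uᵢ(s)² ds. -/

import Mathlib

open scoped RealInnerProductSpace ENNReal Gradient
open Set Filter

noncomputable section

abbrev E (n : ℕ) := EuclideanSpace ℝ (Fin n)

/-- The Hamiltonian `H(x,p) = (1/2) Σᵢ ⟪p, fᵢ(x)⟫²`. -/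
def Ham {n m : ℕ} (f : Fin m → E n → E n) (x p : E n) : ℝ :=
  (1 / 2) * ∑ i, ⟪p, f i x⟫ ^ 2

/-- `(x, p)` is a normal extremal on the set `s ⊆ ℝ`: it solves the Hamiltonian system
`x' = Σᵢ ⟪p, fᵢ(x)⟫ fᵢ(x)`, `p' = -Σᵢ ⟪p, fᵢ(x)⟫ (Dfᵢ(x))ᵀ p` on `s`. -/
def IsNormalExtremalOn {n m : ℕ} (f : Fin m → E n → E n) (x p : ℝ → E n)
    (s : Set ℝ) : Prop :=
  ∀ t ∈ s,
    HasDerivWithinAt x (∑ i, ⟪p t, f i (x t)⟫ • f i (x t)) s t ∧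
    HasDerivWithinAt p
      (-∑ i, ⟪p t, f i (x t)⟫ • (ContinuousLinearMap.adjoint (fderiv ℝ (f i) (x t))) (p t))
      s t

/-- A bounded measurable control on `[0, T]`. -/
def IsBoundedControl {m : ℕ} (T : ℝ) (u : ℝ → Fin m → ℝ) : Prop :=
  Measurable u ∧ ∃ K : ℝ, ∀ t ∈ Icc (0:ℝ) T, ‖u t‖ ≤ K

/-- `y` is a trajectory on `[0, T]` of the control `u` for the vector fields `f`, i.e. an
absolutely continuous curve with `y' (t) = Σᵢ uᵢ(t) fᵢ(y t)` a.e., expressed in integral form. -/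
def IsTrajectoryOn {n m : ℕ} (f : Fin m → E n → E n) (u : ℝ → Fin m → ℝ) (T : ℝ)
    (y : ℝ → E n) : Prop :=
  ContinuousOn y (Icc 0 T) ∧
  ∀ t ∈ Icc (0:ℝ) T, y t = y 0 + ∫ s in (0:ℝ)..t, ∑ i, u s i • f i (y s)

/-- The value function `V(x) ∈ [0, +∞]`: the infimum of the cost `∫₀¹ Σᵢ uᵢ(t)² dt` over all
bounded measurable controls on `[0,1]` admitting a trajectory from `x̄` to `x`. -/
def valueFun {n m : ℕ} (f : Fin m → E n → E n) (xbar : E n) (x : E n) : ℝ≥0∞ :=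
  sInf { c : ℝ≥0∞ | ∃ u : ℝ → Fin m → ℝ, IsBoundedControl 1 u ∧
    ∃ y : ℝ → E n, IsTrajectoryOn f u 1 y ∧ y 0 = xbar ∧ y 1 = x ∧
      c = ENNReal.ofReal (∫ t in (0:ℝ)..1, ∑ i, (u t i) ^ 2) }

theorem valueFun_self {n m : ℕ} (f : Fin m → E n → E n) (xbar : E n) :
    valueFun f xbar xbar = 0 := by
  refine le_antisymm (sInf_le ?_) (zero_le)
  refine ⟨fun _ _ => 0, ⟨measurable_const, 0, ?_⟩, fun _ => xbar, ⟨continuousOn_const, ?_⟩,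
    rfl, rfl, ?_⟩
  · intro t _
    exact (norm_zero (E := Fin m → ℝ)).le
  · intro t _
    simp
  · simp

theorem cost_integrable {m : ℕ} (u : ℝ → Fin m → ℝ) (hu : IsBoundedControl 1 u)
    (a b : ℝ) (ha : 0 ≤ a) (hab : a ≤ b) (hb : b ≤ 1) :
    IntervalIntegrable (fun s => ∑ i, (u s i) ^ 2) MeasureTheory.volume a b := by
  obtain ⟨hm, K, hK⟩ := hu
  rw [intervalIntegrable_iff_integrableOn_Ioc_of_le hab]
  refine MeasureTheory.Measure.integrableOn_of_bounded (M := ∑ i : Fin m, K ^ 2) (by simp) ?_ ?_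
  · have : ∀ i, Measurable fun s => u s i := fun i => (measurable_pi_apply i).comp hm
    exact (Finset.measurable_sum _ fun i _ => (this i).pow_const 2).aestronglyMeasurable
  · refine (MeasureTheory.ae_restrict_iff' measurableSet_Ioc).2 (Eventually.of_forall ?_)
    intro s hs
    rw [Real.norm_of_nonneg (Finset.sum_nonneg fun i _ => sq_nonneg _)]
    refine Finset.sum_le_sum fun i _ => ?_
    have h1 := hK s ⟨ha.trans hs.1.le, hs.2.trans hb⟩
    have h2 := (norm_le_pi_norm (u s) i).trans h1
    rw [Real.norm_eq_abs] at h2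
    exact sq_le_sq' (abs_le.1 h2).1 (abs_le.1 h2).2

theorem core {n m : ℕ} (f : Fin m → E n → E n) (xbar : E n)
    (u : ℝ → Fin m → ℝ) (hu : IsBoundedControl 1 u)
    (γ : ℝ → E n) (hγ : IsTrajectoryOn f u 1 γ)
    (hγi : IntervalIntegrable (fun s => ∑ i, u s i • f i (γ s)) MeasureTheory.volume 0 1)
    (t : ℝ) (ht : t ∈ Ioo (0:ℝ) 1)
    (v : ℝ → Fin m → ℝ) (hv : IsBoundedControl 1 v)
    (z : ℝ → E n) (hz : IsTrajectoryOn f v 1 z)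
    (hzi : IntervalIntegrable (fun s => ∑ i, v s i • f i (z s)) MeasureTheory.volume 0 1)
    (hz0 : z 0 = xbar) (hz1 : z 1 = γ t) :
    valueFun f xbar (γ 1) ≤
      ENNReal.ofReal (1 / t) * ENNReal.ofReal (∫ s in (0:ℝ)..1, ∑ i, (v s i) ^ 2) +
        ENNReal.ofReal (∫ s in t..1, ∑ i, (u s i) ^ 2) := by
  obtain ⟨ht0, ht1⟩ := ht
  have htne : t ≠ 0 := ht0.ne'
  set w : ℝ → Fin m → ℝ := fun s => if s ≤ t then t⁻¹ • v (s / t) else u s with hw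
  set y : ℝ → E n := fun s => if s ≤ t then z (s / t) else γ s with hy
  set gz : ℝ → E n := fun s => ∑ i, v s i • f i (z s) with hgz
  set gγ : ℝ → E n := fun s => ∑ i, u s i • f i (γ s) with hgγ
  set G : ℝ → E n := fun s => ∑ i, w s i • f i (y s) with hG
  have hG1 : ∀ s, s ≤ t → G s = t⁻¹ • gz (s / t) := by
    intro s hs
    simp only [hG, hw, hy, hgz, if_pos hs, Pi.smul_apply, smul_eq_mul, Finset.smul_sum, mul_smul]
  have hG2 : ∀ s, t < s → G s = gγ s := by
    intro s hs
    simp only [hG, hw, hy, hgγ, if_neg (not_le.2 hs)]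
  have hI1 : ∀ s ∈ Icc 0 t, ∫ x in (0:ℝ)..s, G x = ∫ x in (0:ℝ)..(s / t), gz x := by
    intro s hs
    have : ∫ x in (0:ℝ)..s, G x = ∫ x in (0:ℝ)..s, t⁻¹ • gz (x / t) := by
      refine intervalIntegral.integral_congr fun x hx => ?_
      rw [uIcc_of_le hs.1] at hx
      exact hG1 x (hx.2.trans hs.2)
    rw [this, intervalIntegral.integral_smul, intervalIntegral.inv_smul_integral_comp_div, zero_div]
  have hGi1 : IntervalIntegrable G MeasureTheory.volume 0 t := by
    have h1 : IntervalIntegrable (fun x => gz (x / t)) MeasureTheory.volume 0 t := by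
      have := IntervalIntegrable.comp_mul_right hzi (c := t⁻¹)
      simpa [div_eq_mul_inv] using this
    refine (h1.smul t⁻¹).congr ?_
    intro x hx
    rw [uIoc_of_le ht0.le] at hx
    exact (hG1 x hx.2).symm
  have hγt : ∀ s ∈ Icc t 1, IntervalIntegrable gγ MeasureTheory.volume t s := by
    intro s hs
    refine hγi.mono_set ?_
    rw [uIcc_of_le hs.1, uIcc_of_le zero_le_one]
    exact Icc_subset_Icc ht0.le hs.2
  have hGi2 : ∀ s ∈ Icc t 1, IntervalIntegrable G MeasureTheory.volume t s := by
    intro s hs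
    refine (hγt s hs).congr ?_
    intro x hx
    rw [uIoc_of_le hs.1] at hx
    exact (hG2 x hx.1).symm
  have hI2 : ∀ s ∈ Icc t 1, ∫ x in t..s, G x = ∫ x in t..s, gγ x := by
    intro s hs
    refine intervalIntegral.integral_congr_ae (Eventually.of_forall fun x hx => ?_)
    rw [uIoc_of_le hs.1] at hx
    exact hG2 x hx.1
  have hy0 : y 0 = z 0 := by simp [hy, ht0.le]
  have hdiv : ∀ s ∈ Icc 0 t, s / t ∈ Icc (0:ℝ) 1 := fun s hs =>
    ⟨div_nonneg hs.1 ht0.le, (div_le_one ht0).2 hs.2⟩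
  have hy1 : y 1 = γ 1 := by simp [hy, not_le.2 ht1]
  -- the concatenated trajectory
  have hytraj : IsTrajectoryOn f w 1 y := by
    constructor
    · refine ContinuousOn.if (p := fun s => s ≤ t) ?_ ?_ ?_
      · intro a ha
        have h : a = t := by
          have := ha.2
          rw [show {a | a ≤ t} = Iic t from rfl, frontier_Iic] at this
          exact this
        rw [h, div_self htne, hz1]
      · rw [show {a | a ≤ t} = Iic t from rfl, closure_Iic]
        refine hz.1.comp (by fun_prop) ?_
        intro s hs
        exact hdiv s ⟨hs.1.1, hs.2⟩
      · refine hγ.1.mono inter_subset_left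
    · intro s hs
      change y s = y 0 + ∫ x in (0:ℝ)..s, G x
      rcases le_or_gt s t with hst | hst
      · rw [hI1 s ⟨hs.1, hst⟩, hy0, ← hz.2 _ (hdiv s ⟨hs.1, hst⟩)]
        simp [hy, hst]
      · have hs' : s ∈ Icc t 1 := ⟨hst.le, hs.2⟩
        rw [← intervalIntegral.integral_add_adjacent_intervals hGi1 (hGi2 s hs'), hI2 s hs',
          hI1 t ⟨ht0.le, le_rfl⟩, div_self htne, hy0, ← add_assoc,
          ← hz.2 1 ⟨zero_le_one, le_rfl⟩, hz1]
        have e1 := hγ.2 t ⟨ht0.le, ht1.le⟩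
        have e2 := hγ.2 s hs
        have hi0 : IntervalIntegrable gγ MeasureTheory.volume 0 t := by
          refine hγi.mono_set ?_
          rw [uIcc_of_le ht0.le, uIcc_of_le zero_le_one]
          exact Icc_subset_Icc le_rfl ht1.le
        have e3 := intervalIntegral.integral_add_adjacent_intervals hi0 (hγt s hs')
        have : y s = γ s := by simp [hy, not_le.2 hst]
        rw [this, e2, e1, add_assoc]
        exact congrArg _ e3.symm
  have hwb : IsBoundedControl 1 w := by
    obtain ⟨hum, K, hK⟩ := hu
    obtain ⟨hvm, L, hL⟩ := hv
    refine ⟨Measurable.ite measurableSet_Iic ?_ hum, max (t⁻¹ * L) K, ?_⟩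
    · exact (hvm.comp (measurable_id.div_const t)).const_smul t⁻¹
    · intro s hs
      by_cases hst : s ≤ t
      · simp only [hw, if_pos hst]
        rw [norm_smul, Real.norm_of_nonneg (inv_nonneg.2 ht0.le)]
        exact le_max_of_le_left
          (mul_le_mul_of_nonneg_left (hL _ (hdiv s ⟨hs.1, hst⟩)) (inv_nonneg.2 ht0.le))
      · simp only [hw, if_neg hst]
        exact le_max_of_le_right (hK s hs)
  have hc1 : ∫ s in (0:ℝ)..t, ∑ i, (w s i) ^ 2
      = (1 / t) * ∫ s in (0:ℝ)..1, ∑ i, (v s i) ^ 2 := by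
    have : ∫ s in (0:ℝ)..t, ∑ i, (w s i) ^ 2
        = ∫ s in (0:ℝ)..t, t⁻¹ * (t⁻¹ • (fun r => ∑ i, (v r i) ^ 2) (s / t)) := by
      refine intervalIntegral.integral_congr fun x hx => ?_
      rw [uIcc_of_le ht0.le] at hx
      simp only [hw, if_pos hx.2, Pi.smul_apply, smul_eq_mul, mul_pow, Finset.mul_sum]
      refine Finset.sum_congr rfl fun i _ => by ring
    rw [this, intervalIntegral.integral_const_mul, intervalIntegral.integral_smul,
      intervalIntegral.inv_smul_integral_comp_div (fun r => ∑ i, (v r i) ^ 2), zero_div,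
      div_self htne, one_div]
  have hc2 : ∫ s in t..1, ∑ i, (w s i) ^ 2 = ∫ s in t..1, ∑ i, (u s i) ^ 2 := by
    refine intervalIntegral.integral_congr_ae (Eventually.of_forall fun x hx => ?_)
    rw [uIoc_of_le ht1.le] at hx
    simp only [hw, if_neg (not_le.2 hx.1)]
  have hc := intervalIntegral.integral_add_adjacent_intervals
    (cost_integrable w hwb 0 t le_rfl ht0.le ht1.le)
    (cost_integrable w hwb t 1 ht0.le ht1.le le_rfl)
  have hle : valueFun f xbar (γ 1) ≤ ENNReal.ofReal (∫ s in (0:ℝ)..1, ∑ i, (w s i) ^ 2) :=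
    sInf_le ⟨w, hwb, y, hytraj, hy0.trans hz0, hy1, rfl⟩
  refine hle.trans ?_
  rw [← hc, hc1, hc2, ← ENNReal.ofReal_mul (by positivity)]
  exact ENNReal.ofReal_add_le

/-- dynamic programming inequality: if `γ` is a trajectory on `[0,1]` of a
bounded measurable control `u` with `γ(0) = x̄`, then for every `t ∈ (0,1)`,
`V(γ(1)) ≤ (1/t)·V(γ(t)) + ∫_t^1 Σᵢ uᵢ(s)² ds`. -/
theorem stmt_13 {n m : ℕ} (f : Fin m → E n → E n) (xbar : E n)
    (u : ℝ → Fin m → ℝ) (hu : IsBoundedControl 1 u)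
    (γ : ℝ → E n) (hγ : IsTrajectoryOn f u 1 γ) (h0 : γ 0 = xbar)
    (t : ℝ) (ht : t ∈ Ioo (0:ℝ) 1) :
    valueFun f xbar (γ 1) ≤
      ENNReal.ofReal (1 / t) * valueFun f xbar (γ t) +
        ENNReal.ofReal (∫ s in t..1, ∑ i, (u s i) ^ 2) := by
  by_cases hγi : IntervalIntegrable (fun s => ∑ i, u s i • f i (γ s)) MeasureTheory.volume 0 1
  · have key : ∀ c ∈ { c : ℝ≥0∞ | ∃ u : ℝ → Fin m → ℝ, IsBoundedControl 1 u ∧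
        ∃ y : ℝ → E n, IsTrajectoryOn f u 1 y ∧ y 0 = xbar ∧ y 1 = γ t ∧
        c = ENNReal.ofReal (∫ t in (0:ℝ)..1, ∑ i, (u t i) ^ 2) },
        valueFun f xbar (γ 1) ≤ ENNReal.ofReal (1 / t) * c +
          ENNReal.ofReal (∫ s in t..1, ∑ i, (u s i) ^ 2) := by
      rintro c ⟨v, hv, z, hz, hz0, hz1, rfl⟩
      by_cases hzi : IntervalIntegrable (fun s => ∑ i, v s i • f i (z s)) MeasureTheory.volume 0 1
      · exact core f xbar u hu γ hγ hγi t ht v hv z hz hzi hz0 hz1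
      · -- then the integral is zero by convention and `γ t = xbar`: use the zero control
        have h1 := hz.2 1 ⟨zero_le_one, le_rfl⟩
        rw [intervalIntegral.integral_undef hzi, add_zero, hz0] at h1
        have h2 := core f xbar u hu γ hγ hγi t ht (fun _ _ => 0)
          ⟨measurable_const, 0, fun _ _ => (norm_zero (E := Fin m → ℝ)).le⟩ (fun _ => xbar)
          ⟨continuousOn_const, fun _ _ => by simp⟩ (by simp) rfl (h1.symm.trans hz1)
        refine h2.trans (add_le_add_left ?_ _)
        simp
    have hpos : ENNReal.ofReal (1 / t) ≠ 0 := by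
      have := ht.1
      simpa using this
    rw [← tsub_le_iff_right, mul_comm, ← ENNReal.div_le_iff hpos ENNReal.ofReal_ne_top]
    refine le_sInf fun c hc => ?_
    rw [ENNReal.div_le_iff hpos ENNReal.ofReal_ne_top, mul_comm, tsub_le_iff_right]
    exact key c hc
  · have h1 := hγ.2 1 ⟨zero_le_one, le_rfl⟩
    rw [intervalIntegral.integral_undef hγi, add_zero, h0] at h1
    rw [h1, valueFun_self]
    exact zero_le
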